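/- arXiv:2507.18404 — 3 statements merged into one kernel-verified Lean document; each statement's English description precedes it below -/
import Mathlib

section
/- For every real μ and every z₀, z₁, …, z_N ∈ ℝ, the one-step AA Gibbs update for μ_α satisfies the algebraic identity (1/σ_ε²)/λ_{μAA} · Σ_{i<N} Σ_{t<T} [ y i t − ( (1/σ_ε²)·Σ_{s<T}(y i s − μ))/λ_α − z i /√λ_α ] + (φ_α/τ_α²)/λ_{μAA} + z₀/√λ_{μAA} = ((1/σ_ε²)/((1/σ_ε²) + 1/(τ_α²·N·T))) · ( ((T/σ_ε²)/λ_α)·μ + ((1/σ_α²)·ȳ)/λ_α − z̄/√λ_α ) + (φ_α/τ_α²)/λ_{μAA} + z₀/√λ_{μAA}. (Paper's equation (12): closed-form AR(1) representation of the AA Gibbs chain for μ_α.) -/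
open Finset Real

/-- Paper's equation (12): closed-form AR(1) representation of the AA Gibbs chain for μ_α. -/
theorem aa_gibbs_mu_markov (σε σα τα : ℝ) (hσε : 0 < σε) (hσα : 0 < σα) (hτα : 0 < τα)
    (N T : ℕ) (hN : 0 < N) (hT : 0 < T) (φα : ℝ) (y : Fin N → Fin T → ℝ)
    (μ : ℝ) (z₀ : ℝ) (z : Fin N → ℝ) :
    let lamα : ℝ := (T : ℝ) / σε ^ 2 + 1 / σα ^ 2
    let lamμAA : ℝ := (N : ℝ) * T / σε ^ 2 + 1 / τα ^ 2
    let ybar : ℝ := (1 / ((N : ℝ) * T)) * ∑ i, ∑ t, y i t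
    let zbar : ℝ := (1 / (N : ℝ)) * ∑ i, z i
    (1 / σε ^ 2) / lamμAA *
        ∑ i, ∑ t, (y i t - ((1 / σε ^ 2) * ∑ s, (y i s - μ)) / lamα - z i / Real.sqrt lamα)
      + (φα / τα ^ 2) / lamμAA + z₀ / Real.sqrt lamμAA
    = ((1 / σε ^ 2) / ((1 / σε ^ 2) + 1 / (τα ^ 2 * N * T))) *
        ((((T : ℝ) / σε ^ 2) / lamα) * μ + ((1 / σα ^ 2) * ybar) / lamα
          - zbar / Real.sqrt lamα)
      + (φα / τα ^ 2) / lamμAA + z₀ / Real.sqrt lamμAA := by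
  intro lamα lamμAA ybar zbar
  have hN' : (0 : ℝ) < N := by exact_mod_cast hN
  have hT' : (0 : ℝ) < T := by exact_mod_cast hT
  have hlα : 0 < lamα := by positivity
  have hlμ : 0 < lamμAA := by positivity
  have hr : 0 < Real.sqrt lamα := Real.sqrt_pos.mpr hlα
  have hsum : ∑ i, ∑ t, (y i t - ((1 / σε ^ 2) * ∑ s, (y i s - μ)) / lamα
        - z i / Real.sqrt lamα)
      = (∑ i, ∑ t, y i t) - T * ((1 / σε ^ 2) * ((∑ i, ∑ t, y i t) - N * (T * μ))) / lamα
        - T * (∑ i, z i) / Real.sqrt lamα := by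
    simp only [Finset.sum_sub_distrib, Finset.sum_const, Finset.card_univ, Fintype.card_fin,
      nsmul_eq_mul, ← Finset.mul_sum, ← Finset.sum_div]
    ring
  have hcoef : (1 / σε ^ 2) / ((1 / σε ^ 2) + 1 / (τα ^ 2 * N * T))
      = (1 / σε ^ 2) / lamμAA * (N * T) := by
    have : (1 / σε ^ 2) + 1 / (τα ^ 2 * N * T) = lamμAA / (N * T) := by
      simp only [lamμAA]
      field_simp
    rw [this]
    field_simp
  have hσ : 1 / σα ^ 2 = lamα - T / σε ^ 2 := by simp only [lamα]; ring
  rw [hsum, hcoef, hσ, mul_assoc (1 / σε ^ 2 / lamμAA)]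
  congr 3
  simp only [ybar, zbar]
  generalize Real.sqrt lamα = r at *
  clear_value lamα
  field_simp
  ring
end

section
/- Fix innovations z : Fin N → ℝ and w, u ∈ ℝ. For every real μ, let α̃_i = (1/σ_ε²)·(Σ_{t<T} y i t − T·ȳ)/λ_α + (z i − z̄)/√λ_α − w/√λ_{μSA} (the deviations produced by the SA step followed by the approximated SA μ-update with innovations z and w, as in equation (17)), and define the SA→AA ASIS output μ⁺ = (1/σ_ε²)·Σ_{i<N} Σ_{t<T}(y i t − α̃_i)/λ_{μAA} + (φ_α/τ_α²)/λ_{μAA} + u/√λ_{μAA}. Then μ⁺ = (1/σ_ε²)·(N·T·ȳ + N·T·w/√λ_{μSA})/λ_{μAA} + (φ_α/τ_α²)/λ_{μAA} + u/√λ_{μAA}; in particular μ⁺ depends neither on the previous state μ nor on the individual innovations z i. (Core of the paper's Theorem 2 for the SA→AA ASIS sampler.) -/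
open Finset Real

/-- Core of the paper's Theorem 2 for the SA→AA ASIS sampler: the ASIS output μ⁺ depends
neither on the previous state μ nor on the individual innovations z i. -/
theorem asis_sa_aa_output (σε σα τα : ℝ) (hσε : 0 < σε) (hσα : 0 < σα) (hτα : 0 < τα)
    (N T : ℕ) (hN : 0 < N) (hT : 0 < T) (φα : ℝ) (y : Fin N → Fin T → ℝ)
    (z : Fin N → ℝ) (w u : ℝ) :
    let lamα : ℝ := (T : ℝ) / σε ^ 2 + 1 / σα ^ 2
    let lamμSA : ℝ := (N : ℝ) / σα ^ 2 + 1 / τα ^ 2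
    let lamμAA : ℝ := (N : ℝ) * T / σε ^ 2 + 1 / τα ^ 2
    let ybar : ℝ := (1 / ((N : ℝ) * T)) * ∑ j, ∑ t, y j t
    let zbar : ℝ := (1 / (N : ℝ)) * ∑ j, z j
    let αtilde : Fin N → ℝ := fun i =>
      (1 / σε ^ 2) * ((∑ t, y i t) - T * ybar) / lamα
        + (z i - zbar) / Real.sqrt lamα - w / Real.sqrt lamμSA
    (1 / σε ^ 2) * (∑ i, ∑ t, (y i t - αtilde i)) / lamμAA
        + (φα / τα ^ 2) / lamμAA + u / Real.sqrt lamμAA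
      = (1 / σε ^ 2) * ((N : ℝ) * T * ybar + (N : ℝ) * T * w / Real.sqrt lamμSA) / lamμAA
        + (φα / τα ^ 2) / lamμAA + u / Real.sqrt lamμAA := by
  intro lamα lamμSA lamμAA ybar zbar αtilde
  have hN' : (N : ℝ) ≠ 0 := by exact_mod_cast hN.ne'
  have hT' : (T : ℝ) ≠ 0 := by exact_mod_cast hT.ne'
  have hy : ∑ j, ∑ t, y j t = (N : ℝ) * T * ybar := by
    simp only [ybar]
    field_simp
  have hz : ∑ j, z j = (N : ℝ) * zbar := by
    simp only [zbar]
    field_simp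
  have hα : ∑ i, αtilde i = - ((N : ℝ) * (w / Real.sqrt lamμSA)) := by
    have h1 : ∑ i, αtilde i
        = (1 / σε ^ 2) * ((∑ i, ∑ t, y i t) - N * (T * ybar)) / lamα
          + ((∑ i, z i) - N * zbar) / Real.sqrt lamα - N * (w / Real.sqrt lamμSA) := by
      simp only [αtilde, Finset.sum_sub_distrib, Finset.sum_add_distrib, ← Finset.sum_div,
        ← Finset.mul_sum, Finset.sum_const, Finset.card_univ, Fintype.card_fin, nsmul_eq_mul]
      ring
    rw [h1, hy, hz]
    ring
  have hs : ∑ i, ∑ t, (y i t - αtilde i)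
      = (N : ℝ) * T * ybar + (N : ℝ) * T * w / Real.sqrt lamμSA := by
    have h2 : ∑ i, ∑ t, (y i t - αtilde i) = (∑ i, ∑ t, y i t) - T * ∑ i, αtilde i := by
      rw [Finset.mul_sum, ← Finset.sum_sub_distrib]
      refine Finset.sum_congr rfl fun i _ => ?_
      rw [Finset.sum_sub_distrib]
      simp only [Finset.sum_const, Finset.card_univ, Fintype.card_fin, nsmul_eq_mul]
    rw [h2, hα, hy]
    ring
  rw [hs]
end

section
/- Fix innovations z : Fin N → ℝ and w, u ∈ ℝ. For every real μ, let α_i = ((1/σ_ε²)·Σ_{t<T} y i t)/λ_α + ((1/σ_α²)·ȳ)/λ_α + (z i − z̄)/√λ_α + w/√λ_{μAA} (the recentred effects produced by the AA step followed by the approximated AA μ-update with innovations z and w, as in equation (19)), and define the AA→SA ASIS output μ⁺ = (1/σ_α²)·Σ_{i<N} α_i/λ_{μSA} + (φ_α/τ_α²)/λ_{μSA} + u/√λ_{μSA}. Then μ⁺ = (1/σ_α²)·(N·ȳ + N·w/√λ_{μAA})/λ_{μSA} + (φ_α/τ_α²)/λ_{μSA} + u/√λ_{μSA}; in particular μ⁺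 depends neither on the previous state μ nor on the individual innovations z i. (Core of the paper's Theorem 2 for the AA→SA ASIS sampler.) -/
open Finset Real

/-- Core of the paper's Theorem 2 for the AA→SA ASIS sampler: the ASIS output μ⁺ depends
neither on the previous state μ nor on the individual innovations z i. -/
theorem asis_aa_sa_output (σε σα τα : ℝ) (hσε : 0 < σε) (hσα : 0 < σα) (hτα : 0 < τα)
    (N T : ℕ) (hN : 0 < N) (hT : 0 < T) (φα : ℝ) (y : Fin N → Fin T → ℝ)
    (z : Fin N → ℝ) (w u : ℝ) :
    let lamα : ℝ := (T : ℝ) / σε ^ 2 + 1 / σα ^ 2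
    let lamμSA : ℝ := (N : ℝ) / σα ^ 2 + 1 / τα ^ 2
    let lamμAA : ℝ := (N : ℝ) * T / σε ^ 2 + 1 / τα ^ 2
    let ybar : ℝ := (1 / ((N : ℝ) * T)) * ∑ j, ∑ t, y j t
    let zbar : ℝ := (1 / (N : ℝ)) * ∑ j, z j
    let α : Fin N → ℝ := fun i =>
      ((1 / σε ^ 2) * ∑ t, y i t) / lamα + ((1 / σα ^ 2) * ybar) / lamα
        + (z i - zbar) / Real.sqrt lamα + w / Real.sqrt lamμAA
    (1 / σα ^ 2) * (∑ i, α i) / lamμSA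
        + (φα / τα ^ 2) / lamμSA + u / Real.sqrt lamμSA
      = (1 / σα ^ 2) * ((N : ℝ) * ybar + (N : ℝ) * w / Real.sqrt lamμAA) / lamμSA
        + (φα / τα ^ 2) / lamμSA + u / Real.sqrt lamμSA := by
  intro lamα lamμSA lamμAA ybar zbar α
  have hN' : (N : ℝ) ≠ 0 := by positivity
  have hT' : (T : ℝ) ≠ 0 := by positivity
  have hl : lamα ≠ 0 := by
    have : 0 < (T : ℝ) / σε ^ 2 + 1 / σα ^ 2 := by positivity
    exact this.ne'
  have hy : ∑ j, ∑ t, y j t = (N : ℝ) * T * ybar := by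
    simp only [ybar]
    field_simp
  have hz : ∑ j, z j = (N : ℝ) * zbar := by
    simp only [zbar]
    field_simp
  have key : ∑ i, α i = (N : ℝ) * ybar + (N : ℝ) * w / Real.sqrt lamμAA := by
    have h1 : ∑ i, α i = ((1 / σε ^ 2) * ∑ j, ∑ t, y j t) / lamα
        + (N : ℝ) * (((1 / σα ^ 2) * ybar) / lamα)
        + (∑ j, z j - (N : ℝ) * zbar) / Real.sqrt lamα
        + (N : ℝ) * (w / Real.sqrt lamμAA) := by
      simp only [α, Finset.sum_add_distrib, ← Finset.sum_div, ← Finset.mul_sum,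
        Finset.sum_sub_distrib, Finset.sum_const, Finset.card_univ, Fintype.card_fin,
        nsmul_eq_mul]
      ring
    have h2 : ((1 / σε ^ 2) * ((N : ℝ) * T * ybar)) / lamα
        + (N : ℝ) * (((1 / σα ^ 2) * ybar) / lamα) = (N : ℝ) * ybar * (lamα / lamα) := by
      have h3 : lamα = (T : ℝ) / σε ^ 2 + 1 / σα ^ 2 := rfl
      have h4 : (N : ℝ) * ybar * (lamα / lamα)
          = (N : ℝ) * ybar * ((T : ℝ) / σε ^ 2 + 1 / σα ^ 2) / lamα := by
        rw [← h3]
        ring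
      rw [h4]
      generalize lamα = l
      ring
    rw [h1, hy, hz, h2, div_self hl]
    ring
  rw [key]
end
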